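/- Let φ ∈ 𝒜^r be such that {φ(·−n) : n ∈ ℤ} forms a Riesz basis for V(φ). Then for every s = 1, …, r, the constant M_s = esssup_{w∈[0,1]} [Σ_{l∈ℤ} (w+l)^{2s} |φ̂(w+l)|²]/[Σ_{l∈ℤ} |φ̂(w+l)|²] satisfies M_s ≥ 1/4^s. -/

import Mathlib

open MeasureTheory FourierTransform Filter Real Set

noncomputable def Gfun (φ : ℝ → ℂ) (w : ℝ) : ℝ := ∑' l : ℤ, ‖𝓕 φ (w + l)‖ ^ 2

noncomputable def Bfun (φ : ℝ → ℂ) (s : ℕ) (w : ℝ) : ℝ :=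
  (∑' l : ℤ, (w + (l : ℝ)) ^ (2 * s) * ‖𝓕 φ (w + l)‖ ^ 2) / Gfun φ w

noncomputable def Mconst (φ : ℝ → ℂ) (s : ℕ) : ℝ :=
  (essSup (fun w : ℝ => ENNReal.ofReal (Bfun φ s w)) (volume.restrict (Icc (0:ℝ) 1))).toReal

def ClassA (r : ℕ) (φ : ℝ → ℂ) : Prop :=
  ContDiff ℝ r φ ∧
  (∃ ε : ℝ, 0 < ε ∧ ∀ s ≤ r,
      (fun x => iteratedDeriv s φ x) =O[cocompact ℝ] fun x : ℝ => |x| ^ (-(1/2 : ℝ) - ε)) ∧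
  (∀ s, 1 ≤ s → s ≤ r → ∃ C : ℝ, ∀ᵐ w ∂(volume.restrict (Icc (0:ℝ) 1)),
      ∑' l : ℤ, (w + (l : ℝ)) ^ (2 * s) * ‖𝓕 φ (w + l)‖ ^ 2 ≤ C)

def RieszTranslates (φ : ℝ → ℂ) : Prop :=
  ∃ c C : ℝ, 0 < c ∧ c ≤ C ∧ ∀ᵐ w : ℝ, c ≤ Gfun φ w ∧ Gfun φ w ≤ C

theorem memLp_two_of_isBigO_rpow {f : ℝ → ℂ} (hf : Continuous f) {ε : ℝ} (hε : 0 < ε)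
    (h : f =O[cocompact ℝ] fun x : ℝ => |x| ^ (-(1/2 : ℝ) - ε)) : MemLp f 2 := by
  rw [memLp_two_iff_integrable_sq_norm hf.aestronglyMeasurable]
  have hJ : Integrable (fun x : ℝ => (1 + ‖x‖) ^ (-(1 + 2 * ε))) :=
    integrable_one_add_norm (by simp; linarith)
  refine LocallyIntegrable.integrable_of_isBigO_cocompact
    (hf.norm.pow 2).locallyIntegrable ?_ (hJ.integrableAtFilter _)
  refine (h.norm_left.pow 2).trans ?_
  refine Asymptotics.IsBigO.of_bound (2 ^ (1 + 2 * ε)) ?_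
  have hev : ∀ᶠ x : ℝ in cocompact ℝ, 1 ≤ ‖x‖ :=
    (tendsto_norm_cocompact_atTop (E := ℝ)).eventually_ge_atTop 1
  filter_upwards [hev] with x hx
  have hx0 : 0 < |x| := by rw [Real.norm_eq_abs] at hx; linarith
  have h1 : (|x| ^ (-(1/2 : ℝ) - ε)) ^ 2 = |x| ^ (-(1 + 2 * ε)) := by
    rw [← Real.rpow_natCast, ← Real.rpow_mul hx0.le]
    congr 1
    push_cast
    ring
  rw [h1, Real.norm_of_nonneg (by positivity), Real.norm_of_nonneg (by positivity),
    Real.rpow_neg hx0.le, Real.rpow_neg (by positivity), ← div_eq_mul_inv,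
    inv_le_iff_one_le_mul₀ (by positivity), div_mul_eq_mul_div, le_div_iff₀ (by positivity),
    one_mul, ← Real.mul_rpow (by norm_num) hx0.le]
  rw [Real.norm_eq_abs] at *
  exact Real.rpow_le_rpow (by positivity) (by linarith) (by linarith)

theorem integral_iteratedDeriv_mul_fourier {φ : ℝ → ℂ} {r : ℕ} (hφ : ContDiff ℝ r φ)
    (hL : ∀ k ≤ r, MemLp (iteratedDeriv k φ) 2) (hi : Integrable φ) :
    ∀ k ≤ r, ∀ ψ : SchwartzMap ℝ ℂ,
      ∫ x, iteratedDeriv k φ x * 𝓕 ψ x = ∫ x, (2 * π * Complex.I * x) ^ k * 𝓕 φ x * ψ x := by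
  intro k
  induction k with
  | zero =>
    intro _ ψ
    have := VectorFourier.integral_fourierIntegral_smul_eq_flip (L := innerₗ ℝ)
      Real.continuous_fourierChar continuous_inner hi (ψ.integrable (μ := volume))
    simpa [SchwartzMap.fourier_coe] using! this.symm
  | succ k ih =>
    intro hk ψ
    have hT : (fun x : ℝ => 2 * π * Complex.I * x).HasTemperateGrowth := by fun_prop
    set η : SchwartzMap ℝ ℂ := SchwartzMap.smulLeftCLM ℂ (fun x : ℝ => 2 * π * Complex.I * x) ψ
    have hη : ∀ x, η x = (2 * π * Complex.I * x) * ψ x := fun x => by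
      simp [η, SchwartzMap.smulLeftCLM_apply_apply hT]
    have hder : ∀ x, HasDerivAt (𝓕 ψ : SchwartzMap ℝ ℂ) (-(𝓕 η : SchwartzMap ℝ ℂ) x) x := by
      intro x
      have hx : Integrable (fun x : ℝ => x • ψ x) := by
        refine (η.integrable.const_mul (2 * π * Complex.I)⁻¹).congr (.of_forall fun x => ?_)
        have : (2 * π * Complex.I) ≠ 0 := Complex.two_pi_I_ne_zero
        simp only [hη, Complex.real_smul]
        field_simp
      have he : 𝓕 (fun x : ℝ => (-2 * π * Complex.I * x) • ψ x) x = -𝓕 (η : ℝ → ℂ) x := by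
        rw [Real.fourier_eq, Real.fourier_eq, ← integral_neg]
        congr 1
        ext v
        rw [hη, smul_eq_mul, ← smul_neg]
        congr 1
        ring
      rw [SchwartzMap.fourier_coe, SchwartzMap.fourier_coe, ← he]
      exact Real.hasDerivAt_fourier ψ.integrable hx x
    have hD : ∀ x, HasDerivAt (iteratedDeriv k φ) (iteratedDeriv (k + 1) φ x) x := by
      intro x
      rw [iteratedDeriv_succ]
      exact (hφ.differentiable_iteratedDeriv k (by exact_mod_cast hk) x).hasDerivAt
    have h2 : ∀ θ : SchwartzMap ℝ ℂ, MemLp θ 2 := fun θ => θ.memLp 2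
    have hp := integral_mul_deriv_eq_deriv_mul_of_integrable
      (fun x _ => hD x) (fun x _ => hder x)
      ((hL k (by omega)).integrable_mul (h2 (𝓕 η)).neg)
      ((hL (k + 1) hk).integrable_mul (h2 (𝓕 ψ)))
      ((hL k (by omega)).integrable_mul (h2 (𝓕 ψ)))
    have hI := ih (by omega) η
    simp only [mul_neg, integral_neg, neg_inj] at hp
    rw [← hp, hI]
    congr 1
    ext x
    rw [hη]
    ring

theorem integrable_pow_mul_norm_fourier_sq {φ : ℝ → ℂ} {s : ℕ} (hφ : ContDiff ℝ s φ)
    (hL : ∀ k ≤ s, MemLp (iteratedDeriv k φ) 2) (hi : Integrable φ) :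
    Integrable fun x : ℝ => x ^ (2 * s) * ‖𝓕 φ x‖ ^ 2 := by
  set H : Lp ℂ 2 (volume : Measure ℝ) := (hL s le_rfl).toLp
  set G : Lp ℂ 2 (volume : Measure ℝ) := 𝓕 H
  have hc : Continuous (𝓕 φ) := VectorFourier.fourierIntegral_continuous
    Real.continuous_fourierChar (L := innerₗ ℝ) continuous_inner hi
  set F : ℝ → ℂ := fun x => (2 * π * Complex.I * x) ^ s * 𝓕 φ x
  have hF : Continuous F := by fun_prop
  have hG : LocallyIntegrable G := (Lp.memLp G).locallyIntegrable (by norm_num)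
  have hpair (ψ : SchwartzMap ℝ ℂ) : ∫ x, ψ x * G x = ∫ x, ψ x * F x := by
    have h1 := congrArg (fun T => T ψ) (Lp.fourier_toTemperedDistribution_eq H)
    simp only [TemperedDistribution.fourier_apply, Lp.toTemperedDistribution_apply,
      smul_eq_mul] at h1
    rw [← h1]
    have h2 := integral_iteratedDeriv_mul_fourier hφ hL hi s le_rfl ψ
    calc _ = ∫ x, iteratedDeriv s φ x * 𝓕 ψ x := by
          refine integral_congr_ae ?_
          filter_upwards [(hL s le_rfl).coeFn_toLp] with x hx
          rw [hx, mul_comm]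
      _ = _ := by
          rw [h2]
          simp only [F, mul_comm]
  have hae : ∀ᵐ x : ℝ, (G x - F x) = 0 := by
    refine ae_eq_zero_of_integral_contDiff_smul_eq_zero
      (hG.sub hF.locallyIntegrable) fun g hg hgc => ?_
    have hg₁ : HasCompactSupport (Complex.ofRealCLM ∘ g) := hgc.comp_left rfl
    have hg₂ : ContDiff ℝ ((⊤ : ℕ∞) : WithTop ℕ∞) (Complex.ofRealCLM ∘ g) := by fun_prop
    have h := hpair (hg₁.toSchwartzMap hg₂)
    have i1 := hG.integrable_smul_left_of_hasCompactSupport hg.continuous hgc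
    have i2 := hF.locallyIntegrable.integrable_smul_left_of_hasCompactSupport (μ := volume)
      hg.continuous hgc
    simp only [smul_sub]
    rw [integral_sub i1 i2, sub_eq_zero]
    simpa using h
  have hFL : MemLp F 2 := (memLp_congr_ae (by
    filter_upwards [hae] with x hx using sub_eq_zero.1 hx)).1 (Lp.memLp G)
  have hsq := (memLp_two_iff_integrable_sq_norm hFL.1).1 hFL
  refine (hsq.const_mul (((2 * π) ^ (2 * s))⁻¹)).congr (.of_forall fun x => ?_)
  have hx : ‖F x‖ ^ 2 = (2 * π) ^ (2 * s) * (x ^ (2 * s) * ‖𝓕 φ x‖ ^ 2) := by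
    simp only [F, norm_mul, norm_pow, Complex.norm_real, Complex.norm_I, Complex.norm_ofNat,
      Real.norm_eq_abs, abs_of_pos Real.pi_pos, mul_one]
    rw [mul_pow, ← pow_mul, mul_comm s 2, mul_pow, pow_mul |x|, sq_abs, ← pow_mul]
    ring
  simp only [hx]
  field_simp

theorem ae_summable_int_translates {f : ℝ → ℝ} (hf : Integrable f) :
    ∀ᵐ w ∂(volume.restrict (Ioc (0 : ℝ) 1)), Summable fun l : ℤ => f (w + l) := by
  have hm : ∀ l : ℤ, AEMeasurable (fun w : ℝ => ‖f (w + l)‖ₑ) (volume.restrict (Ioc (0 : ℝ) 1)) :=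
    fun l => ((hf.comp_add_right (l : ℝ)).1.enorm).restrict
  have h1 : ∫⁻ w in Ioc (0 : ℝ) 1, ∑' l : ℤ, ‖f (w + l)‖ₑ = ∫⁻ w, ‖f w‖ₑ := by
    rw [lintegral_tsum hm, ← setLIntegral_univ, ← iUnion_Ioc_intCast ℝ,
      lintegral_iUnion (fun _ => measurableSet_Ioc) (pairwise_disjoint_Ioc_intCast ℝ)]
    congr 1
    ext l
    have := (measurePreserving_add_right volume (l : ℝ)).setLIntegral_comp_preimage_emb
      (measurableEmbedding_addRight (l : ℝ)) (fun x => ‖f x‖ₑ) (Ioc (l : ℝ) (l + 1))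
    rw [← this]
    simp
  have h2 : ∫⁻ w in Ioc (0 : ℝ) 1, ∑' l : ℤ, ‖f (w + l)‖ₑ ≠ ⊤ := by
    rw [h1]; exact hf.2.ne
  filter_upwards [ae_lt_top' (AEMeasurable.tsum hm) h2] with w hw
  exact Summable.of_enorm hw.ne

theorem min_le_abs_add_int {w : ℝ} (l : ℤ) :
    min w (1 - w) ≤ |w + l| := by
  rcases le_or_gt 0 l with hl | hl
  · have : (0 : ℝ) ≤ l := by exact_mod_cast hl
    exact (min_le_left _ _).trans (le_trans (by linarith) (le_abs_self _))
  · have : (l : ℝ) ≤ -1 := by exact_mod_cast (by omega : l ≤ -1)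
    exact (min_le_right _ _).trans (le_trans (by linarith) (neg_le_abs _))

theorem integrable_of_rieszTranslates {φ : ℝ → ℂ} (hR : RieszTranslates φ) : Integrable φ := by
  obtain ⟨c, C, hc, -, h⟩ := hR
  by_contra hn
  have h0 : ∀ w, 𝓕 φ w = 0 := fun w => by
    rw [Real.fourier_eq]
    exact integral_undef fun h => hn ((Real.fourierIntegral_convergent_iff w).1 h)
  obtain ⟨w, hw, -⟩ := h.exists
  simp only [Gfun, h0] at hw
  simp at hw
  linarith

theorem stmt1 (r : ℕ) (φ : ℝ → ℂ) (hφ : ClassA r φ) (hR : RieszTranslates φ)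
    (s : ℕ) (hs1 : 1 ≤ s) (hsr : s ≤ r) :
    (1 : ℝ) / 4 ^ s ≤ Mconst φ s := by
  have hi := integrable_of_rieszTranslates hR
  obtain ⟨hcd, ⟨ε, hε, hO⟩, hC⟩ := hφ
  obtain ⟨C, hC⟩ := hC s hs1 hsr
  obtain ⟨c, D, hc, -, hG⟩ := hR
  have hL : ∀ k ≤ s, MemLp (iteratedDeriv k φ) 2 := fun k hk =>
    memLp_two_of_isBigO_rpow (hcd.continuous_iteratedDeriv k (by exact_mod_cast hk.trans hsr)) hε
      (hO k (hk.trans hsr))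
  have h_integrable := integrable_pow_mul_norm_fourier_sq (hcd.of_le (by exact_mod_cast hsr)) hL hi
  have hsum := ae_summable_int_translates h_integrable
  rw [restrict_Ioc_eq_restrict_Icc] at hsum
  have hG' := ae_restrict_of_ae (s := Icc (0 : ℝ) 1) hG
  set E := essSup (fun w : ℝ => ENNReal.ofReal (Bfun φ s w)) (volume.restrict (Icc (0:ℝ) 1))
    with hE
  have hEtop : E ≠ ⊤ := by
    refine ne_top_of_le_ne_top (ENNReal.ofReal_ne_top (r := C / c)) (essSup_le_of_ae_le _ ?_)
    filter_upwards [hG', hC] with w hw hCw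
    refine ENNReal.ofReal_le_ofReal ?_
    have hnum : 0 ≤ ∑' l : ℤ, (w + (l : ℝ)) ^ (2 * s) * ‖𝓕 φ (w + l)‖ ^ 2 :=
      tsum_nonneg fun l => mul_nonneg (Even.pow_nonneg (even_two_mul s) _) (sq_nonneg _)
    exact div_le_div₀ (hnum.trans hCw) hCw hc hw.1
  have hae : ∀ᵐ w ∂(volume.restrict (Icc (0:ℝ) 1)), min w (1 - w) ^ (2 * s) ≤ E.toReal := by
    filter_upwards [hG', hsum, ENNReal.ae_le_essSup (fun w : ℝ => ENNReal.ofReal (Bfun φ s w)),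
      ae_restrict_mem measurableSet_Icc] with w hw hsw hEw hw01
    refine le_trans ?_ ((ENNReal.ofReal_le_iff_le_toReal hEtop).1 hEw)
    have hGpos : 0 < Gfun φ w := hc.trans_le hw.1
    have hGs : Summable fun l : ℤ => ‖𝓕 φ (w + l)‖ ^ 2 := by
      by_contra hns
      exact hGpos.ne' (tsum_eq_zero_of_not_summable hns)
    rw [Bfun, le_div_iff₀ hGpos, Gfun, ← tsum_mul_left]
    refine (hGs.mul_left _).tsum_le_tsum (fun l => ?_) hsw
    refine mul_le_mul_of_nonneg_right ?_ (sq_nonneg _)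
    rw [← (even_two_mul s).pow_abs (w + l)]
    exact pow_le_pow_left₀ (le_min hw01.1 (by linarith [hw01.2]))
      (min_le_abs_add_int l) _
  change 1 / 4 ^ s ≤ E.toReal
  by_contra! hlt
  rw [ae_restrict_iff' measurableSet_Icc] at hae
  have hopen : IsOpen ({w : ℝ | E.toReal < min w (1 - w) ^ (2 * s)} ∩ Ioo 0 1) :=
    (isOpen_lt continuous_const (by fun_prop)).inter isOpen_Ioo
  have hhalf : (1 / 2 : ℝ) ∈ {w : ℝ | E.toReal < min w (1 - w) ^ (2 * s)} ∩ Ioo 0 1 := by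
    refine ⟨?_, by norm_num, by norm_num⟩
    have : min (1 / 2 : ℝ) (1 - 1 / 2) ^ (2 * s) = 1 / 4 ^ s := by
      rw [pow_mul, ← one_div_pow]
      norm_num
    rw [mem_ofPred_eq, this]
    exact hlt
  refine (hopen.measure_pos volume ⟨_, hhalf⟩).ne' (measure_mono_null ?_ (ae_iff.1 hae))
  rintro w ⟨hw, hw'⟩ h
  exact absurd (h (Ioo_subset_Icc_self hw')) (not_le.2 hw)
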